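/- arXiv:2301.12329 — 2 statements merged into one kernel-verified Lean document; each statement's English description precedes it below -/
import Mathlib

section
/- Let ≽ be a binary relation on ℝ^n and let T(x) = conv(N(x) ∩ S[0,1]), where S[0,1] is the unit sphere of ℝ^n. If ≽ is upper semicontinuous, then T is closed, i.e. its graph {(x, x*) ∈ ℝ^n × ℝ^n : x* ∈ T(x)} is a closed subset of ℝ^n × ℝ^n. -/
open RealInnerProductSpace

noncomputable section

/-- Euclidean space ℝ^n. -/
abbrev Euc (n : ℕ) := EuclideanSpace ℝ (Fin n)

/-- The asymmetric (strict) part of the binary relation `R`: `x ≻ y`. -/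
def SP {n : ℕ} (R : Euc n → Euc n → Prop) (x y : Euc n) : Prop := R x y ∧ ¬ R y x

/-- The strict upper contour set `Uˢ(x) = {y : y ≻ x}`. -/
def Us {n : ℕ} (R : Euc n → Euc n → Prop) (x : Euc n) : Set (Euc n) := {y | SP R y x}

/-- The strict lower contour set `Lˢ(x) = {y : x ≻ y}`. -/
def Ls {n : ℕ} (R : Euc n → Euc n → Prop) (x : Euc n) : Set (Euc n) := {y | SP R x y}

/-- The normal cone `𝒩_A(x)`.  Note that when `A = ∅` this set is (vacuously) all of `ℝ^n`,
as in the definition in the paper. -/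
def nCone {n : ℕ} (A : Set (Euc n)) (x : Euc n) : Set (Euc n) :=
  {p | ∀ y ∈ A, ⟪p, y - x⟫ ≤ 0}

/-- The normal cone correspondence `N(x) = 𝒩_{Uˢ(x)}(x)` associated to `R`. -/
def N {n : ℕ} (R : Euc n → Euc n → Prop) (x : Euc n) : Set (Euc n) := nCone (Us R x) x

/-- `N*(x)`: strict version of the normal cone.  When `Uˢ(x) = ∅` this set is
(vacuously) all of `ℝ^n`, as in the definition in the paper. -/
def Nstar {n : ℕ} (R : Euc n → Euc n → Prop) (x : Euc n) : Set (Euc n) :=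
  {p | ∀ y ∈ Us R x, ⟪p, y - x⟫ < 0}

/-- The correspondence `T(x) = conv(N(x) ∩ S[0,1])`, where `S[0,1]` is the unit sphere. -/
def T {n : ℕ} (R : Euc n → Euc n → Prop) (x : Euc n) : Set (Euc n) :=
  convexHull ℝ (N R x ∩ Metric.sphere (0 : Euc n) 1)

/-- **Carathéodory's theorem** with a fixed number of points: in a finite-dimensional space, every
point of the convex hull of `s` is a convex combination of `finrank + 1` points of `s`. -/
theorem mem_convexHull_iff_exists_stdSimplex {E : Type*} [AddCommGroup E] [Module ℝ E]
    [FiniteDimensional ℝ E] {s : Set E} {x : E} :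
    x ∈ convexHull ℝ s ↔ ∃ w ∈ stdSimplex ℝ (Fin (Module.finrank ℝ E + 1)),
      ∃ z : Fin (Module.finrank ℝ E + 1) → E, (∀ i, z i ∈ s) ∧ ∑ i, w i • z i = x := by
  constructor
  · intro hx
    obtain ⟨ι, _, z, w, hz, hind, hw, hw1, hsum⟩ := eq_pos_convex_span_of_mem_convexHull hx
    obtain ⟨z₀, hz₀⟩ : s.Nonempty := convexHull_nonempty_iff.mp ⟨x, hx⟩
    have hcard : Fintype.card ι ≤ Fintype.card (Fin (Module.finrank ℝ E + 1)) := by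
      rw [Fintype.card_fin]
      exact hind.card_le_finrank_succ.trans
        (Nat.add_le_add_right (Submodule.finrank_le _) 1)
    obtain ⟨e⟩ := Function.Embedding.nonempty_of_card_le hcard
    have hwe (i : ι) : Function.extend e w 0 (e i) = w i := e.injective.extend_apply _ _ _
    have hze (i : ι) : Function.extend e z (fun _ => z₀) (e i) = z i :=
      e.injective.extend_apply _ _ _
    have hw0 (j) (hj : j ∉ Set.range e) : Function.extend e w 0 j = 0 :=
      Function.extend_apply' _ _ _ hj
    refine ⟨Function.extend e w 0, ⟨fun j => ?_, ?_⟩, Function.extend e z (fun _ => z₀),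
      fun j => ?_, ?_⟩
    · by_cases hj : j ∈ Set.range e
      · obtain ⟨i, rfl⟩ := hj
        rw [hwe]
        exact (hw i).le
      · rw [hw0 j hj]
    · rw [← hw1]
      exact (Fintype.sum_of_injective e e.injective _ _ hw0 fun i => (hwe i).symm).symm
    · by_cases hj : j ∈ Set.range e
      · obtain ⟨i, rfl⟩ := hj
        rw [hze]
        exact hz ⟨i, rfl⟩
      · rw [Function.extend_apply' _ _ _ hj]
        exact hz₀
    · rw [← hsum]
      refine (Fintype.sum_of_injective e e.injective _ _ (fun j hj => ?_) fun i => ?_).symm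
      · rw [hw0 j hj, zero_smul]
      · rw [hwe, hze]
  · rintro ⟨w, hw, z, hz, rfl⟩
    exact (convex_convexHull ℝ s).sum_mem (fun i _ => hw.1 i) hw.2
      fun i _ => subset_convexHull ℝ s (hz i)

/-- If a correspondence with values in a compact subset of a finite-dimensional space has closed
graph, then so does the correspondence of its convex hulls. -/
theorem isClosed_graph_convexHull {X E : Type*} [TopologicalSpace X] [AddCommGroup E]
    [Module ℝ E] [FiniteDimensional ℝ E] [TopologicalSpace E] [T2Space E]
    [IsTopologicalAddGroup E] [ContinuousSMul ℝ E] {F : X → Set E} {K : Set E} (hK : IsCompact K)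
    (hFK : ∀ x, F x ⊆ K) (hF : IsClosed {p : X × E | p.2 ∈ F p.1}) :
    IsClosed {p : X × E | p.2 ∈ convexHull ℝ (F p.1)} := by
  let ι := Fin (Module.finrank ℝ E + 1)
  have : CompactSpace K := isCompact_iff_compactSpace.mp hK
  have : CompactSpace (stdSimplex ℝ ι) :=
    isCompact_iff_compactSpace.mp (isCompact_stdSimplex ℝ ι)
  let Z : Set ((X × E) × (stdSimplex ℝ ι × (ι → K))) :=
    {q | (∀ i, (q.2.2 i : E) ∈ F q.1.1) ∧ ∑ i, (q.2.1 : ι → ℝ) i • (q.2.2 i : E) = q.1.2}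
  have hZ : IsClosed Z := by
    refine IsClosed.and ?_ ?_
    · simp only [Set.ofPred_forall]
      refine isClosed_iInter fun i => ?_
      exact hF.preimage (f := fun q : (X × E) × (stdSimplex ℝ ι × (ι → K)) =>
        (q.1.1, (q.2.2 i : E))) (by fun_prop)
    · refine isClosed_eq (continuous_finsetSum _ fun i _ => Continuous.smul ?_ ?_) (by fun_prop)
      · exact (continuous_apply i).comp (continuous_subtype_val.comp (by fun_prop))
      · fun_prop
  convert isClosedMap_fst_of_compactSpace Z hZ using 1
  ext p
  constructor
  · intro hp
    obtain ⟨w, hw, z, hz, hsum⟩ := mem_convexHull_iff_exists_stdSimplex.mp hp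
    exact ⟨(p, ⟨w, hw⟩, fun i => ⟨z i, hFK _ (hz i)⟩), ⟨hz, hsum⟩, rfl⟩
  · rintro ⟨⟨p, w, z⟩, ⟨hz, hsum⟩, rfl⟩
    exact mem_convexHull_iff_exists_stdSimplex.mpr ⟨w, w.2, fun i => z i, hz, hsum⟩

/-- The normal cone correspondence of an upper semicontinuous relation has closed graph. -/
theorem isClosed_graph_N {n : ℕ} (R : Euc n → Euc n → Prop)
    (husc : ∀ x : Euc n, IsOpen (Ls R x)) :
    IsClosed {p : Euc n × Euc n | p.2 ∈ N R p.1} := by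
  have hgraph : {p : Euc n × Euc n | p.2 ∈ N R p.1} =
      ⋂ y, {p | p.1 ∈ Ls R y → ⟪p.2, y - p.1⟫ ≤ 0} := by
    ext p
    simp only [Set.mem_iInter]
    rfl
  rw [hgraph]
  refine isClosed_iInter fun y => isClosed_imp ?_ ?_
  · exact (husc y).preimage continuous_fst
  · exact isClosed_le (by fun_prop) continuous_const

/-- If `R` is upper semicontinuous, then `T` is closed:
its graph is a closed subset of `ℝ^n × ℝ^n`. -/
theorem stmt_8 {n : ℕ} (R : Euc n → Euc n → Prop)
    (husc : ∀ x : Euc n, IsOpen (Ls R x)) :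
    IsClosed {p : Euc n × Euc n | p.2 ∈ T R p.1} := by
  refine isClosed_graph_convexHull (isCompact_sphere (0 : Euc n) 1)
    (fun _ => Set.inter_subset_right) ?_
  exact (isClosed_graph_N R husc).inter (Metric.isClosed_sphere.preimage continuous_snd)
end
end

section
/- Let X be a non-empty subset of ℝ^n and let ≽ be a lower semicontinuous binary relation on ℝ^n. Then every solution of the Stampacchia variational inequality problem for T and X is a maximal element of ≽ on X: SVIP(T, X) ⊆ ME(X), where T(x) = conv(N(x) ∩ S[0,1]). -/
open RealInnerProductSpace

noncomputable section

/-- A nonzero normal vector to an open set is strictly negative on that set. -/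
theorem inner_neg_of_mem_nCone {n : ℕ} {A : Set (Euc n)} (hA : IsOpen A) {x p y : Euc n}
    (hp : p ∈ nCone A x) (hp0 : p ≠ 0) (hy : y ∈ A) : ⟪p, y - x⟫ < 0 := by
  obtain ⟨ε, hε, hball⟩ := Metric.isOpen_iff.mp hA y hy
  have hnorm : 0 < ‖p‖ := norm_pos_iff.mpr hp0
  have hmem : y + (ε / 2 / ‖p‖) • p ∈ A := by
    apply hball
    rw [Metric.mem_ball, dist_self_add_left, norm_smul, Real.norm_of_nonneg (by positivity),
      div_mul_cancel₀ _ hnorm.ne']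
    linarith
  have hle := hp _ hmem
  rw [add_sub_right_comm, inner_add_right, real_inner_smul_right,
    real_inner_self_eq_norm_sq] at hle
  have hpos : 0 < ε / 2 / ‖p‖ * ‖p‖ ^ 2 := by positivity
  linarith

/-- Every element of `T R x` is strictly negative on an open strict upper contour set. -/
theorem inner_neg_of_mem_T {n : ℕ} {R : Euc n → Euc n → Prop} {x p y : Euc n}
    (hopen : IsOpen (Us R x)) (hp : p ∈ T R x) (hy : y ∈ Us R x) : ⟪p, y - x⟫ < 0 := by
  have hconv : Convex ℝ {q : Euc n | ⟪q, y - x⟫ < 0} :=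
    convex_halfSpace_lt ⟨fun _ _ => inner_add_left _ _ _,
      fun _ _ => real_inner_smul_left _ _ _⟩ 0
  refine convexHull_min (fun q hq => ?_) hconv hp
  exact inner_neg_of_mem_nCone hopen hq.1 (ne_zero_of_mem_unit_sphere ⟨q, hq.2⟩) hy

/-- Let `X ⊆ ℝ^n` be non-empty and `R` lower semicontinuous.
Then every solution of the Stampacchia variational inequality problem for `T` and `X`
is a maximal element of `R` on `X`:  `SVIP(T, X) ⊆ ME(X)`. -/
theorem stmt_10 {n : ℕ} (X : Set (Euc n)) (hX : X.Nonempty)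
    (R : Euc n → Euc n → Prop)
    (hlsc : ∀ x : Euc n, IsOpen (Us R x)) :
    ∀ xhat : Euc n, xhat ∈ X →
      (∃ xs ∈ T R xhat, ∀ y ∈ X, 0 ≤ ⟪xs, y - xhat⟫) →
      Us R xhat ∩ X = ∅ := by
  rintro xhat - ⟨xs, hxs, hsol⟩
  rw [Set.eq_empty_iff_forall_notMem]
  rintro y ⟨hyU, hyX⟩
  exact (inner_neg_of_mem_T (hlsc xhat) hxs hyU).not_ge (hsol y hyX)
end
end
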